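/- (AB-inaccessibility criterion.) Assume the QSE conjecture in both forms: for every two-qubit state σ, (i) if ‖b(σ)‖ < 1 and ‖c_A(σ)‖ > 1/2 then B(σ) ≤ 1, and (ii) if ‖a(σ)‖ < 1 and ‖c_B(σ)‖ > 1/2 then B(σ) ≤ 1. Let ρ be a two-qubit state with ‖a(ρ)‖ < 1, ‖b(ρ)‖ < 1, ‖c_A(ρ)‖ > 1/2 and ‖c_B(ρ)‖ > 1/2. Then for every invertible f_A with ‖a(ρ'_FA)‖ < 1 one has B(ρ'_FA) ≤ 1, and for every invertible f_B with ‖b(ρ'_FB)‖ < 1 one has B(ρ'_FB) ≤ 1; that is, the hidden CHSH-inequality violation of ρ is locally inaccessible from both sides. -/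

import Mathlib

open Matrix Kronecker Complex
open scoped ComplexOrder

noncomputable section

/-- 2×2 complex matrices (one qubit operators). -/
abbrev Mat2 := Matrix (Fin 2) (Fin 2) ℂ
/-- 4×4 complex matrices, indexed by ℂ²⊗ℂ² product indices (two qubit operators). -/
abbrev Mat4 := Matrix (Fin 2 × Fin 2) (Fin 2 × Fin 2) ℂ

/-- A two-qubit state: positive semidefinite with trace 1. -/
def IsState (ρ : Mat4) : Prop := ρ.PosSemidef ∧ ρ.trace = 1

/-- The Pauli matrices σ₁, σ₂, σ₃ (indexed by 0,1,2). -/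
def pauli : Fin 3 → Mat2 :=
  ![!![0, 1; 1, 0], !![0, -Complex.I; Complex.I, 0], !![1, 0; 0, -1]]

/-- Alice's Bloch vector: a_i = tr((σ_i ⊗ 𝟙)ρ). -/
def aVec (ρ : Mat4) : Fin 3 → ℝ := fun i => ((pauli i ⊗ₖ (1 : Mat2)) * ρ).trace.re
/-- Bob's Bloch vector: b_i = tr((𝟙 ⊗ σ_i)ρ). -/
def bVec (ρ : Mat4) : Fin 3 → ℝ := fun i => (((1 : Mat2) ⊗ₖ pauli i) * ρ).trace.re
/-- Correlation matrix: T_{ij} = tr((σ_i ⊗ σ_j)ρ). -/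
def Tmat (ρ : Mat4) : Matrix (Fin 3) (Fin 3) ℝ :=
  Matrix.of fun i j => ((pauli i ⊗ₖ pauli j) * ρ).trace.re

/-- Euclidean norm on ℝ³. -/
def norm3 (v : Fin 3 → ℝ) : ℝ := Real.sqrt (∑ i, v i ^ 2)

/-- Alice's quantum steering ellipsoid centre c_A = γ_b²(a − T b), γ_b² = 1/(1 − ‖b‖²). -/
def cA (ρ : Mat4) : Fin 3 → ℝ :=
  (1 - norm3 (bVec ρ) ^ 2)⁻¹ • (aVec ρ - Tmat ρ *ᵥ bVec ρ)
/-- Bob's quantum steering ellipsoid centre c_B = γ_a²(b − Tᵀ a), γ_a² = 1/(1 − ‖a‖²). -/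
def cB (ρ : Mat4) : Fin 3 → ℝ :=
  (1 - norm3 (aVec ρ) ^ 2)⁻¹ • (bVec ρ - (Tmat ρ)ᵀ *ᵥ aVec ρ)

/-- Alice's QSE matrix Q_A = γ_b²(T − a bᵀ)(𝟙₃ + γ_b² b bᵀ)(Tᵀ − b aᵀ). -/
def QA (ρ : Mat4) : Matrix (Fin 3) (Fin 3) ℝ :=
  (1 - norm3 (bVec ρ) ^ 2)⁻¹ •
    ((Tmat ρ - vecMulVec (aVec ρ) (bVec ρ)) *
      (1 + (1 - norm3 (bVec ρ) ^ 2)⁻¹ • vecMulVec (bVec ρ) (bVec ρ)) *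
      ((Tmat ρ)ᵀ - vecMulVec (bVec ρ) (aVec ρ)))

/-- Bob's QSE matrix Q_B = γ_a²(Tᵀ − b aᵀ)(𝟙₃ + γ_a² a aᵀ)(T − a bᵀ). -/
def QB (ρ : Mat4) : Matrix (Fin 3) (Fin 3) ℝ :=
  (1 - norm3 (aVec ρ) ^ 2)⁻¹ •
    (((Tmat ρ)ᵀ - vecMulVec (bVec ρ) (aVec ρ)) *
      (1 + (1 - norm3 (aVec ρ) ^ 2)⁻¹ • vecMulVec (aVec ρ) (aVec ρ)) *
      (Tmat ρ - vecMulVec (aVec ρ) (bVec ρ)))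

/-- The Alice-filtered state ρ'_FA = (f⊗𝟙)ρ(f⊗𝟙)† / tr[(f†f⊗𝟙)ρ]. -/
def filterA (ρ : Mat4) (f : Mat2) : Mat4 :=
  ((((fᴴ * f) ⊗ₖ (1 : Mat2)) * ρ).trace)⁻¹ • ((f ⊗ₖ (1 : Mat2)) * ρ * (f ⊗ₖ (1 : Mat2))ᴴ)

/-- The Bob-filtered state ρ'_FB = (𝟙⊗f)ρ(𝟙⊗f)† / tr[(𝟙⊗f†f)ρ]. -/
def filterB (ρ : Mat4) (f : Mat2) : Mat4 :=
  ((((1 : Mat2) ⊗ₖ (fᴴ * f)) * ρ).trace)⁻¹ • (((1 : Mat2) ⊗ₖ f) * ρ * ((1 : Mat2) ⊗ₖ f)ᴴ)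

/-- The two-sided filtered state (f_A⊗f_B)ρ(f_A⊗f_B)† / tr[(f_A†f_A ⊗ f_B†f_B)ρ]. -/
def filterAB (ρ : Mat4) (f g : Mat2) : Mat4 :=
  ((((fᴴ * f) ⊗ₖ (gᴴ * g)) * ρ).trace)⁻¹ • ((f ⊗ₖ g) * ρ * (f ⊗ₖ g)ᴴ)

/-- The qubit observable α·σ for α ∈ ℝ³. -/
def obs (α : Fin 3 → ℝ) : Mat2 := ∑ k, (α k : ℂ) • pauli k

/-- The expectation value ⟨A⊗B⟩_ρ = tr((A⊗B)ρ) (real for states/Hermitian observables). -/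
def expVal (ρ : Mat4) (A B : Mat2) : ℝ := ((A ⊗ₖ B) * ρ).trace.re

/-- The CHSH functional ½(⟨A¹B¹⟩+⟨A¹B²⟩+⟨A²B¹⟩−⟨A²B²⟩). -/
def chshVal (ρ : Mat4) (α1 α2 β1 β2 : Fin 3 → ℝ) : ℝ :=
  (expVal ρ (obs α1) (obs β1) + expVal ρ (obs α1) (obs β2)
    + expVal ρ (obs α2) (obs β1) - expVal ρ (obs α2) (obs β2)) / 2

/-- The maximal CHSH value B(ρ) over measurement directions (unit vectors in ℝ³). -/
def Bval (ρ : Mat4) : ℝ :=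
  sSup {x | ∃ α1 α2 β1 β2 : Fin 3 → ℝ, norm3 α1 = 1 ∧ norm3 α2 = 1 ∧
    norm3 β1 = 1 ∧ norm3 β2 = 1 ∧ x = chshVal ρ α1 α2 β1 β2}

/-- The F₃ functional (1/√3)Σᵢ tr((Aⁱ⊗σᵢ)ρ). -/
def f3Val (ρ : Mat4) (α : Fin 3 → Fin 3 → ℝ) : ℝ :=
  (∑ i, expVal ρ (obs (α i)) (pauli i)) / Real.sqrt 3

/-- The maximal F₃ value over measurement directions. -/
def F3val (ρ : Mat4) : ℝ :=
  sSup {x | ∃ α : Fin 3 → Fin 3 → ℝ, (∀ i, norm3 (α i) = 1) ∧ x = f3Val ρ α}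

/-- Partial trace over Bob (second factor). -/
def trB (M : Mat4) : Mat2 := Matrix.of fun i j => ∑ k, M (i, k) (j, k)
/-- Partial trace over Alice (first factor). -/
def trA (M : Mat4) : Mat2 := Matrix.of fun i j => ∑ k, M (k, i) (k, j)

/-- The vector |φ⁺(θ)⟩ = cosθ|00⟩ + sinθ|11⟩. -/
def phiVec (θ : ℝ) : Fin 2 × Fin 2 → ℂ :=
  fun q => if q = (0, 0) then (Real.cos θ : ℂ) else if q = (1, 1) then (Real.sin θ : ℂ) else 0

/-- The projector φ⁺(θ) = |φ⁺(θ)⟩⟨φ⁺(θ)|. -/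
def phiProj (θ : ℝ) : Mat4 := vecMulVec (phiVec θ) (star (phiVec θ))

/-- ρ_A(θ) = tr_B φ⁺(θ) = diag(cos²θ, sin²θ). -/
def rhoA (θ : ℝ) : Mat2 := !![(Real.cos θ : ℂ) ^ 2, 0; 0, (Real.sin θ : ℂ) ^ 2]

/-- Partially entangled state with one-sided coloured noise. -/
def rhoM (θ p : ℝ) : Mat4 :=
  (p : ℂ) • phiProj θ + ((1 - p : ℝ) : ℂ) • (rhoA θ ⊗ₖ ((1 / 2 : ℂ) • (1 : Mat2)))

/-- Partially entangled state with symmetric coloured noise. -/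
def rhoMM (θ p : ℝ) : Mat4 :=
  (p : ℂ) • phiProj θ + ((1 - p : ℝ) : ℂ) • (rhoA θ ⊗ₖ rhoA θ)

/-- The vector |Φ⁺⟩ = (|00⟩+|11⟩)/√2. -/
def maxEntVec : Fin 2 × Fin 2 → ℂ :=
  fun q => if q.1 = q.2 then ((Real.sqrt 2 : ℂ))⁻¹ else 0

/-- The projector Φ⁺ = |Φ⁺⟩⟨Φ⁺|. -/
def maxEntProj : Mat4 := vecMulVec maxEntVec (star maxEntVec)

/-- The singlet vector |Ψ⁻⟩ = (|01⟩−|10⟩)/√2. -/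
def singletVec : Fin 2 × Fin 2 → ℂ :=
  fun q => if q = (0, 1) then ((Real.sqrt 2 : ℂ))⁻¹
    else if q = (1, 0) then -((Real.sqrt 2 : ℂ))⁻¹ else 0

/-- The singlet projector |Ψ⁻⟩⟨Ψ⁻|. -/
def singletProj : Mat4 := vecMulVec singletVec (star singletVec)

/-- The vector |00⟩. -/
def zeroVec : Fin 2 × Fin 2 → ℂ := fun q => if q = (0, 0) then 1 else 0

/-- The quasi-distillable state ρ_QD(p) = p|Ψ⁻⟩⟨Ψ⁻| + (1−p)|00⟩⟨00|. -/
def rhoQD (p : ℝ) : Mat4 :=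
  (p : ℂ) • singletProj + ((1 - p : ℝ) : ℂ) • vecMulVec zeroVec (star zeroVec)

/-- The Pauli matrices are Hermitian. -/
lemma pauli_isHermitian (i : Fin 3) : (pauli i).IsHermitian := by
  fin_cases i <;> ext j k <;> fin_cases j <;> fin_cases k <;> simp [pauli]

/-- The partial trace of `(𝟙 ⊗ X) ρ` determines every correlation with `X` on Bob's side. -/
lemma trace_kronecker_mul (P X : Mat2) (ρ : Mat4) :
    ((P ⊗ₖ X) * ρ).trace = (P * trB (((1 : Mat2) ⊗ₖ X) * ρ)).trace := by
  simp [Matrix.trace, Matrix.mul_apply, trB, Fintype.sum_prod_type, Matrix.one_apply]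
  ring

/-- The partial trace over Bob is covariant under operators acting on Alice's side. -/
lemma trB_one_kronecker_mul_conj (f X : Mat2) (ρ : Mat4) :
    trB (((1 : Mat2) ⊗ₖ X) * ((f ⊗ₖ (1 : Mat2)) * ρ * (f ⊗ₖ (1 : Mat2))ᴴ)) =
      f * trB (((1 : Mat2) ⊗ₖ X) * ρ) * fᴴ := by
  ext i j
  simp [Matrix.mul_apply, trB, Fintype.sum_prod_type, Matrix.one_apply]
  ring

lemma trB_smul (c : ℂ) (M : Mat4) : trB (c • M) = c • trB M := by
  ext i j
  simp [trB, mul_add]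

/-- The Minkowski form of the Pauli coordinates of two 2×2 matrices is twice the trace pairing
with the adjugate, i.e. the polarized determinant. -/
lemma trace_mul_trace_sub_sum_pauli (G H : Mat2) :
    G.trace * H.trace - ∑ i, (pauli i * H).trace * (pauli i * G).trace =
      2 * (G.adjugate * H).trace := by
  simp [Fin.sum_univ_three, pauli, Matrix.trace_fin_two, Matrix.adjugate_fin_two,
    Matrix.mul_apply, Matrix.vecMul, dotProduct]
  linear_combination (G 1 0 - G 0 1) * (H 1 0 - H 0 1) * (-Complex.I_sq)

lemma trace_adjugate_mul_conj (f G H : Mat2) :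
    ((f * G * fᴴ).adjugate * (f * H * fᴴ)).trace =
      f.det * fᴴ.det * (G.adjugate * H).trace := by
  rw [Matrix.adjugate_mul_distrib, Matrix.adjugate_mul_distrib]
  calc _ = (fᴴ.adjugate * G.adjugate * (f.adjugate * f) * H * fᴴ).trace := by
        simp only [Matrix.mul_assoc]
    _ = (fᴴ * fᴴ.adjugate * (G.adjugate * (f.adjugate * f) * H)).trace := by
        rw [Matrix.trace_mul_comm]
        simp only [Matrix.mul_assoc]
    _ = _ := by
        simp [Matrix.adjugate_mul, Matrix.mul_adjugate]
        ring

/-- Products of Hermitian matrices have real trace. -/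
lemma ofReal_re_trace_mul {n : Type*} [Fintype n] {M N : Matrix n n ℂ}
    (hM : M.IsHermitian) (hN : N.IsHermitian) : (((M * N).trace.re : ℝ) : ℂ) = (M * N).trace := by
  rw [← Complex.conj_eq_iff_re]
  calc (starRingEnd ℂ) (M * N).trace = ((M * N)ᴴ).trace := (Matrix.trace_conjTranspose _).symm
    _ = (M * N).trace := by
      rw [Matrix.conjTranspose_mul, hM.eq, hN.eq, Matrix.trace_mul_comm]

lemma ofReal_re_trace_kronecker_mul {P X : Mat2} (hP : P.IsHermitian) (hX : X.IsHermitian)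
    {ρ : Mat4} (hρ : ρ.IsHermitian) :
    ((((P ⊗ₖ X) * ρ).trace.re : ℝ) : ℂ) = ((P ⊗ₖ X) * ρ).trace :=
  ofReal_re_trace_mul (by rw [Matrix.IsHermitian, Matrix.conjTranspose_kronecker, hP.eq, hX.eq]) hρ

lemma norm3_sq (v : Fin 3 → ℝ) : norm3 v ^ 2 = ∑ i, v i ^ 2 :=
  Real.sq_sqrt (Finset.sum_nonneg fun _ _ => sq_nonneg _)

/-- Bob's ellipsoid centre in terms of the operators `tr_B((𝟙 ⊗ X)ρ)` on Alice's side. -/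
lemma ofReal_cB {ρ : Mat4} (hρ : IsState ρ) (j : Fin 3) :
    (cB ρ j : ℂ) =
      (((trB (((1 : Mat2) ⊗ₖ (1 : Mat2)) * ρ)).adjugate *
          trB (((1 : Mat2) ⊗ₖ pauli j) * ρ)).trace) /
        ((trB (((1 : Mat2) ⊗ₖ (1 : Mat2)) * ρ)).adjugate *
          trB (((1 : Mat2) ⊗ₖ (1 : Mat2)) * ρ)).trace := by
  have h1 : (1 : Mat2).IsHermitian := Matrix.isHermitian_one
  have hH : ρ.IsHermitian := hρ.1.isHermitian
  set G := trB (((1 : Mat2) ⊗ₖ (1 : Mat2)) * ρ) with hG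
  set H := trB (((1 : Mat2) ⊗ₖ pauli j) * ρ) with hHdef
  have htr : G.trace = 1 := by
    have h := trace_kronecker_mul 1 1 ρ
    rw [Matrix.one_mul, ← hG, Matrix.one_kronecker_one, Matrix.one_mul, hρ.2] at h
    exact h.symm
  have ha (i : Fin 3) : (aVec ρ i : ℂ) = (pauli i * G).trace := by
    rw [hG, ← trace_kronecker_mul]
    exact ofReal_re_trace_kronecker_mul (pauli_isHermitian i) h1 hH
  have hb : (bVec ρ j : ℂ) = H.trace := by
    rw [← Matrix.one_mul H, hHdef, ← trace_kronecker_mul]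
    exact ofReal_re_trace_kronecker_mul h1 (pauli_isHermitian j) hH
  have hT (i : Fin 3) : (Tmat ρ i j : ℂ) = (pauli i * H).trace := by
    rw [hHdef, ← trace_kronecker_mul]
    exact ofReal_re_trace_kronecker_mul (pauli_isHermitian i) (pauli_isHermitian j) hH
  have hden : ((1 - norm3 (aVec ρ) ^ 2 : ℝ) : ℂ) = 2 * (G.adjugate * G).trace := by
    rw [← trace_mul_trace_sub_sum_pauli, norm3_sq]
    push_cast
    simp only [ha, htr, sq, mul_one]
  have hnum : ((bVec ρ - (Tmat ρ)ᵀ *ᵥ aVec ρ) j : ℂ) = 2 * (G.adjugate * H).trace := by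
    rw [← trace_mul_trace_sub_sum_pauli, htr, one_mul]
    simp only [Pi.sub_apply, Matrix.mulVec, dotProduct, Matrix.transpose_apply]
    push_cast
    simp only [ha, hb, hT]
  rw [cB, Pi.smul_apply, smul_eq_mul, Complex.ofReal_mul, Complex.ofReal_inv, hden, hnum,
    inv_mul_eq_div, mul_div_mul_left _ _ two_ne_zero]

lemma trace_filterA_normalization (ρ : Mat4) (f : Mat2) :
    (((fᴴ * f) ⊗ₖ (1 : Mat2)) * ρ).trace =
      ((f ⊗ₖ (1 : Mat2)) * ρ * (f ⊗ₖ (1 : Mat2))ᴴ).trace := by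
  rw [Matrix.trace_mul_comm _ ((f ⊗ₖ (1 : Mat2))ᴴ), ← Matrix.mul_assoc,
    Matrix.conjTranspose_kronecker, ← Matrix.mul_kronecker_mul, Matrix.conjTranspose_one,
    Matrix.one_mul]

/-- The normalization of a filtered state is nonzero when the filter is invertible. -/
lemma trace_filterA_ne_zero {ρ : Mat4} (hρ : IsState ρ) {f : Mat2} (hf : IsUnit f) :
    (((fᴴ * f) ⊗ₖ (1 : Mat2)) * ρ).trace ≠ 0 := by
  rw [trace_filterA_normalization]
  intro h
  have hF : IsUnit (f ⊗ₖ (1 : Mat2)) := by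
    rw [Matrix.isUnit_iff_isUnit_det] at hf ⊢
    simpa [Matrix.det_kronecker] using hf
  have hz := (hρ.1.mul_mul_conjTranspose_same (f ⊗ₖ (1 : Mat2))).trace_eq_zero_iff.mp h
  have hFs : IsUnit (f ⊗ₖ (1 : Mat2))ᴴ := hF.star
  rw [hFs.mul_left_eq_zero, hF.mul_right_eq_zero] at hz
  simpa [hz] using hρ.2

/-- Filtering a state with an invertible filter gives a state. -/
lemma IsState.filterA {ρ : Mat4} (hρ : IsState ρ) {f : Mat2} (hf : IsUnit f) :
    IsState (filterA ρ f) := by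
  have h0 := trace_filterA_ne_zero hρ hf
  have hps := hρ.1.mul_mul_conjTranspose_same (f ⊗ₖ (1 : Mat2))
  refine ⟨?_, ?_⟩
  · refine hps.smul ?_
    rw [trace_filterA_normalization]
    exact inv_nonneg.mpr hps.trace_nonneg
  · rw [_root_.filterA, Matrix.trace_smul, ← trace_filterA_normalization, smul_eq_mul,
      inv_mul_cancel₀ h0]

/-- Bob's ellipsoid centre is invariant under Alice's local filters. -/
lemma cB_filterA {ρ : Mat4} (hρ : IsState ρ) {f : Mat2} (hf : IsUnit f) :
    cB (filterA ρ f) = cB ρ := by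
  have h0 := trace_filterA_ne_zero hρ hf
  have hd : f.det ≠ 0 := ((Matrix.isUnit_iff_isUnit_det f).mp hf).ne_zero
  have hd' : fᴴ.det ≠ 0 := by simpa [Matrix.det_conjTranspose] using hd
  funext j
  apply Complex.ofReal_injective
  rw [ofReal_cB (hρ.filterA hf), ofReal_cB hρ]
  simp only [filterA, Matrix.mul_smul, trB_smul, trB_one_kronecker_mul_conj,
    Matrix.adjugate_smul, Matrix.smul_mul, Matrix.trace_smul, trace_adjugate_mul_conj,
    smul_eq_mul, Fintype.card_fin, Nat.add_one_sub_one, pow_one]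
  have hc := inv_ne_zero h0
  rw [mul_div_mul_left _ _ hc, mul_div_mul_left _ _ hc, mul_div_mul_left _ _ (mul_ne_zero hd hd')]

/-- Exchanging the two parties. -/
def swapParties (ρ : Mat4) : Mat4 := ρ.submatrix Prod.swap Prod.swap

lemma trace_swapParties (ρ : Mat4) : (swapParties ρ).trace = ρ.trace :=
  (Equiv.prodComm (Fin 2) (Fin 2)).sum_comp fun q => ρ q q

lemma swapParties_mul (M N : Mat4) :
    swapParties (M * N) = swapParties M * swapParties N :=
  (Matrix.submatrix_mul_equiv M N _ (Equiv.prodComm (Fin 2) (Fin 2)) _).symm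

lemma swapParties_kronecker (P X : Mat2) : swapParties (P ⊗ₖ X) = X ⊗ₖ P := by
  ext i j
  exact mul_comm _ _

lemma swapParties_swapParties (ρ : Mat4) : swapParties (swapParties ρ) = ρ := rfl

lemma trace_kronecker_mul_swapParties (P X : Mat2) (ρ : Mat4) :
    ((P ⊗ₖ X) * swapParties ρ).trace = ((X ⊗ₖ P) * ρ).trace := by
  rw [← swapParties_kronecker, ← swapParties_mul, trace_swapParties]

lemma isState_swapParties {ρ : Mat4} (hρ : IsState ρ) : IsState (swapParties ρ) :=
  ⟨hρ.1.submatrix _, (trace_swapParties ρ).trans hρ.2⟩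

lemma cB_swapParties (ρ : Mat4) : cB (swapParties ρ) = cA ρ := by
  have ha : aVec (swapParties ρ) = bVec ρ := by
    funext i
    simp only [aVec, bVec, trace_kronecker_mul_swapParties]
  have hb : bVec (swapParties ρ) = aVec ρ := by
    funext i
    simp only [aVec, bVec, trace_kronecker_mul_swapParties]
  have hT : (Tmat (swapParties ρ))ᵀ = Tmat ρ := by
    ext i j
    simp only [Tmat, Matrix.transpose_apply, Matrix.of_apply, trace_kronecker_mul_swapParties]
  rw [cB, cA, ha, hb, hT]

lemma swapParties_filterA (ρ : Mat4) (f : Mat2) :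
    swapParties (filterA (swapParties ρ) f) = filterB ρ f := by
  have hs (c : ℂ) (M : Mat4) : swapParties (c • M) = c • swapParties M := rfl
  have hc (M : Mat4) : swapParties Mᴴ = (swapParties M)ᴴ := rfl
  simp only [filterA, filterB, hs, hc, swapParties_mul, swapParties_kronecker,
    swapParties_swapParties, trace_kronecker_mul_swapParties]

lemma IsState.filterB {ρ : Mat4} (hρ : IsState ρ) {f : Mat2} (hf : IsUnit f) :
    IsState (filterB ρ f) := by
  rw [← swapParties_filterA]
  exact isState_swapParties ((isState_swapParties hρ).filterA hf)

/-- Alice's ellipsoid centre is invariant under Bob's local filters. -/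
lemma cA_filterB {ρ : Mat4} (hρ : IsState ρ) {f : Mat2} (hf : IsUnit f) :
    cA (filterB ρ f) = cA ρ := by
  rw [← cB_swapParties, ← swapParties_filterA, swapParties_swapParties,
    cB_filterA (isState_swapParties hρ) hf, cB_swapParties]

/-- AB-inaccessibility criterion: assuming both forms of the QSE conjecture,
if ‖c_A(ρ)‖ > 1/2 and ‖c_B(ρ)‖ > 1/2 then neither Alice nor Bob alone can reveal any
hidden CHSH-inequality violation. -/
theorem stmt_6
    (conjA : ∀ σ : Mat4, IsState σ → norm3 (bVec σ) < 1 → 1 / 2 < norm3 (cA σ) →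
      Bval σ ≤ 1)
    (conjB : ∀ σ : Mat4, IsState σ → norm3 (aVec σ) < 1 → 1 / 2 < norm3 (cB σ) →
      Bval σ ≤ 1)
    (ρ : Mat4) (hρ : IsState ρ)
    (ha : norm3 (aVec ρ) < 1) (hb : norm3 (bVec ρ) < 1)
    (hcA : 1 / 2 < norm3 (cA ρ)) (hcB : 1 / 2 < norm3 (cB ρ)) :
    (∀ fA : Mat2, IsUnit fA → norm3 (aVec (filterA ρ fA)) < 1 →
      Bval (filterA ρ fA) ≤ 1) ∧
    (∀ fB : Mat2, IsUnit fB → norm3 (bVec (filterB ρ fB)) < 1 →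
      Bval (filterB ρ fB) ≤ 1) := by
  refine ⟨fun f hf h => conjB _ (hρ.filterA hf) h ?_, fun f hf h => conjA _ (hρ.filterB hf) h ?_⟩
  · rwa [cB_filterA hρ hf]
  · rwa [cA_filterB hρ hf]

end
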